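/- For the one-sided test with the independence encompassing prior defined below, as |θ̂| → ∞ with at least one coordinate of θ̂ going to +∞, the ratio k(Θ1; θ̂)/k(Θ0; θ̂) → 1; more precisely, for t = 0, 1, k(Θt; θ̂) · (νs² + s_y² + θ̂ᵀQθ̂)^{(n−r2+ν)/2} → 1. Consequently the Bayes factor B10 = (P_π(θ ≤ 0)^{−1} − 1)^{−1} · k(Θ1; θ̂)/k(Θ0; θ̂) converges to (P_π(θ ≤ 0)^{−1} − 1)^{−1}, a finite constant, so B10 is information inconsistent. -/

import Mathlib

open MeasureTheory Filter Matrix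

noncomputable section

/-- The closed negative orthant of ℝ^r. -/
def negOrthant (r : ℕ) : Set (EuclideanSpace ℝ (Fin r)) := {ξ | ∀ i, ξ i ≤ 0}


lemma aux_quad_lower {r : ℕ} (Q : Matrix (Fin r) (Fin r) ℝ) (hQ : Q.PosDef) :
    ∃ c : ℝ, 0 < c ∧ ∀ x : EuclideanSpace ℝ (Fin r), c * ‖x‖ ^ 2 ≤ x ⬝ᵥ Q.mulVec x := by
  have hcont : Continuous (fun x : EuclideanSpace ℝ (Fin r) => x ⬝ᵥ Q.mulVec x) := by
    fun_prop
  rcases (Metric.sphere (0 : EuclideanSpace ℝ (Fin r)) 1).eq_empty_or_nonempty with he | hne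
  · refine ⟨1, one_pos, fun x => ?_⟩
    have hx : x = 0 := by
      by_contra hx
      have : (‖x‖⁻¹ • x) ∈ Metric.sphere (0 : EuclideanSpace ℝ (Fin r)) 1 := by
        simp [norm_smul, hx]
      rw [he] at this
      exact this
    simp [hx]
  · obtain ⟨z, hz, hmin⟩ := (isCompact_sphere (0 : EuclideanSpace ℝ (Fin r)) 1).exists_isMinOn
      hne hcont.continuousOn
    have hz0 : z.ofLp ≠ 0 := by
      intro h
      have : z = 0 := by ext i; simp [h]
      simp [this] at hz
    refine ⟨z ⬝ᵥ Q.mulVec z, by simpa using hQ.dotProduct_mulVec_pos hz0, fun x => ?_⟩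
    by_cases hx : x = 0
    · simp [hx]
    have hx' : ‖x‖ ≠ 0 := by simpa using hx
    have hm : (‖x‖⁻¹ • x) ∈ Metric.sphere (0 : EuclideanSpace ℝ (Fin r)) 1 := by
      simp [norm_smul, hx]
    have h := hmin hm
    simp only [Set.mem_ofPred_eq, WithLp.ofLp_smul, smul_dotProduct, dotProduct_smul,
      mulVec_smul, smul_eq_mul] at h
    have h2 := mul_le_mul_of_nonneg_right h (sq_nonneg ‖x‖)
    refine h2.trans (le_of_eq ?_)
    field_simp

lemma aux_bilin {r : ℕ} (Q : Matrix (Fin r) (Fin r) ℝ) :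
    ∃ K : ℝ, 0 < K ∧ ∀ x y : EuclideanSpace ℝ (Fin r), |x ⬝ᵥ Q.mulVec y| ≤ K * ‖x‖ * ‖y‖ := by
  let T := Matrix.toEuclideanCLM (n := Fin r) (𝕜 := ℝ) Q
  refine ⟨‖T‖ + 1, by positivity, fun x y => ?_⟩
  have h1 : x ⬝ᵥ Q.mulVec y = inner ℝ (T y) x := by
    simp [T, EuclideanSpace.inner_eq_star_dotProduct]
  rw [h1]
  have h2 := abs_real_inner_le_norm (T y) x
  have h3 := T.le_opNorm y
  have := norm_nonneg x
  have := norm_nonneg y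
  nlinarith [mul_le_mul_of_nonneg_right h3 (norm_nonneg x), mul_nonneg (norm_nonneg x) (norm_nonneg y)]

lemma aux_sub {r : ℕ} (Q : Matrix (Fin r) (Fin r) ℝ) (hQ : Q.PosDef)
    (x y : EuclideanSpace ℝ (Fin r)) :
    (x - y) ⬝ᵥ Q.mulVec (x - y) = x ⬝ᵥ Q.mulVec x - 2 * (x ⬝ᵥ Q.mulVec y) + y ⬝ᵥ Q.mulVec y := by
  have hs : y ⬝ᵥ Q.mulVec x = x ⬝ᵥ Q.mulVec y := by
    have hT : Qᵀ = Q := by simpa using hQ.isHermitian.eq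
    rw [dotProduct_mulVec, ← mulVec_transpose, hT, dotProduct_comm]
  simp only [WithLp.ofLp_sub, mulVec_sub, dotProduct_sub, sub_dotProduct, hs]
  ring

lemma aux_nonneg {r : ℕ} (Q : Matrix (Fin r) (Fin r) ℝ) (hQ : Q.PosDef)
    (x : EuclideanSpace ℝ (Fin r)) : 0 ≤ x ⬝ᵥ Q.mulVec x := by
  simpa using hQ.posSemidef.dotProduct_mulVec_nonneg x.ofLp

/-- Pointwise convergence of the ratio. -/
lemma aux_ratio {r : ℕ} (Q : Matrix (Fin r) (Fin r) ℝ) (hQ : Q.PosDef) (C : ℝ) (hC : 0 < C)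
    (h : ℕ → EuclideanSpace ℝ (Fin r)) (hn : Tendsto (fun k => ‖h k‖) atTop atTop)
    (x : EuclideanSpace ℝ (Fin r)) :
    Tendsto (fun k => (C + (x - h k) ⬝ᵥ Q.mulVec (x - h k)) / (C + h k ⬝ᵥ Q.mulVec (h k)))
      atTop (nhds 1) := by
  obtain ⟨c, hc, hlow⟩ := aux_quad_lower Q hQ
  obtain ⟨K, hK, hup⟩ := aux_bilin Q
  set N := x ⬝ᵥ Q.mulVec x with hN
  have hN0 : 0 ≤ N := aux_nonneg Q hQ x
  have e : ∀ k, (C + (x - h k) ⬝ᵥ Q.mulVec (x - h k)) / (C + h k ⬝ᵥ Q.mulVec (h k)) =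
      1 + (N - 2 * (x ⬝ᵥ Q.mulVec (h k))) / (C + h k ⬝ᵥ Q.mulVec (h k)) := by
    intro k
    have := aux_nonneg Q hQ (h k)
    rw [aux_sub Q hQ]
    field_simp
    ring
  simp only [e]
  suffices hh : Tendsto (fun k => (N - 2 * (x ⬝ᵥ Q.mulVec (h k))) / (C + h k ⬝ᵥ Q.mulVec (h k)))
      atTop (nhds 0) by simpa using hh.const_add 1
  have hlim : Tendsto (fun k => ((N + 2 * K * ‖x‖) / c) * ‖h k‖⁻¹) atTop (nhds 0) := by
    simpa using (hn.inv_tendsto_atTop).const_mul ((N + 2 * K * ‖x‖) / c)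
  apply squeeze_zero_norm' _ hlim
  filter_upwards [hn.eventually_ge_atTop 1] with k hk
  have h0 := aux_nonneg Q hQ (h k)
  have hl := hlow (h k)
  have hb := abs_le.1 (hup x (h k))
  have hx := norm_nonneg x
  have hden : 0 < c * ‖h k‖ ^ 2 := by positivity
  rw [Real.norm_eq_abs, abs_div, abs_of_pos (by linarith : 0 < C + h k ⬝ᵥ Q.mulVec (h k))]
  have hnum : |N - 2 * (x ⬝ᵥ Q.mulVec (h k))| ≤ (N + 2 * K * ‖x‖) * ‖h k‖ := by
    rw [abs_le]
    constructor <;> nlinarith [hb.1, hb.2]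
  calc _ ≤ ((N + 2 * K * ‖x‖) * ‖h k‖) / (c * ‖h k‖ ^ 2) := by
        apply div_le_div₀ (by positivity) hnum hden (by linarith)
    _ = _ := by field_simp

/-- Domination of the ratio. -/
lemma aux_dom {r : ℕ} (Q : Matrix (Fin r) (Fin r) ℝ) (hQ : Q.PosDef) (C : ℝ) (hC : 0 < C)
    (x h : EuclideanSpace ℝ (Fin r)) :
    (C + h ⬝ᵥ Q.mulVec h) / (C + (x - h) ⬝ᵥ Q.mulVec (x - h)) ≤
      2 + 2 / C * (x ⬝ᵥ Q.mulVec x) := by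
  have h1 := aux_nonneg Q hQ (x - h)
  have h2 := aux_nonneg Q hQ (x - (h - x))
  have h3 := aux_sub Q hQ x h
  have h4 := aux_nonneg Q hQ x
  have h5 := aux_nonneg Q hQ h
  have key : h ⬝ᵥ Q.mulVec h ≤ 2 * (x ⬝ᵥ Q.mulVec x) + 2 * ((x - h) ⬝ᵥ Q.mulVec (x - h)) := by
    have h6 : (x - (h - x)) = (2 : ℝ) • x - h := by rw [two_smul]; abel
    have h7 := aux_sub Q hQ ((2 : ℝ) • x) h
    rw [h6] at h2
    simp only [WithLp.ofLp_sub] at h2 h3 h7 ⊢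
    rw [h7] at h2
    simp only [WithLp.ofLp_smul, smul_dotProduct, dotProduct_smul, mulVec_smul, smul_eq_mul] at h2
    linarith
  have h1' : 0 ≤ (x.ofLp - h.ofLp) ⬝ᵥ Q.mulVec (x.ofLp - h.ofLp) := by simpa using h1
  rw [div_le_iff₀ (by rw [WithLp.ofLp_sub]; linarith)]
  have : 0 ≤ 2 / C * (x ⬝ᵥ Q.mulVec x) * ((x.ofLp - h.ofLp) ⬝ᵥ Q.mulVec (x.ofLp - h.ofLp)) := by
    positivity
  have e : 2 / C * (x ⬝ᵥ Q.mulVec x) * C = 2 * (x ⬝ᵥ Q.mulVec x) := by field_simp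
  simp only [WithLp.ofLp_sub] at key ⊢
  nlinarith

/-- Integrability of the dominating function. -/
lemma aux_int {r : ℕ} (Q W : Matrix (Fin r) (Fin r) ℝ) (hQ : Q.PosDef) (hW : W.PosDef)
    (C p : ℝ) (hC : 0 < C) (hp : 0 ≤ p) :
    Integrable (fun x : EuclideanSpace ℝ (Fin r) =>
      (2 + 2 / C * (x ⬝ᵥ Q.mulVec x)) ^ p * Real.exp (-(x ⬝ᵥ W.mulVec x) / 2)) := by
  obtain ⟨c, hc, hlow⟩ := aux_quad_lower W hW
  obtain ⟨K, hK, hup⟩ := aux_bilin Q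
  set ε := c / (4 * (p + 1)) with hε
  have hεpos : 0 < ε := by positivity
  have hpε : p * ε ≤ c / 4 := by
    rw [hε]; rw [mul_div_assoc', div_le_div_iff₀ (by positivity) (by positivity)]; nlinarith
  set A := 2 + 2 / C * K / ε with hA
  have hApos : 0 < A := by positivity
  have hg : Integrable (fun x : EuclideanSpace ℝ (Fin r) => A ^ p * Real.exp (-(c / 4) * ‖x‖ ^ 2)) := by
    apply Integrable.const_mul
    have := (GaussianFourier.integrable_cexp_neg_mul_sq_norm_add (V := EuclideanSpace ℝ (Fin r))
      (b := ((c / 4 : ℝ) : ℂ)) (by simpa using by positivity) 0 0).norm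
    refine this.congr (ae_of_all _ fun x => ?_)
    simp only [Complex.norm_exp]
    congr 1
    simp [← Complex.ofReal_pow]
  refine hg.mono' ?_ (ae_of_all _ fun x => ?_)
  · apply Continuous.aestronglyMeasurable
    apply Continuous.mul
    · exact Continuous.rpow_const (by fun_prop) (fun _ => Or.inr hp)
    · fun_prop
  · have hq0 := aux_nonneg Q hQ x
    have hq1 : x ⬝ᵥ Q.mulVec x ≤ K * ‖x‖ ^ 2 := by
      have := (abs_le.1 (hup x x)).2; nlinarith
    have hb : 0 ≤ 2 + 2 / C * (x ⬝ᵥ Q.mulVec x) := by positivity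
    rw [Real.norm_of_nonneg (by positivity)]
    have s1 : 2 + 2 / C * (x ⬝ᵥ Q.mulVec x) ≤ A * Real.exp (ε * ‖x‖ ^ 2) := by
      have e1 := Real.add_one_le_exp (ε * ‖x‖ ^ 2)
      have e2 : 2 / C * (x ⬝ᵥ Q.mulVec x) ≤ 2 / C * (K * ‖x‖ ^ 2) := by gcongr
      have e3 : A * (ε * ‖x‖ ^ 2 + 1) = 2 + 2 / C * (K * ‖x‖ ^ 2) + 2 * (ε * ‖x‖ ^ 2) + 2 / C * K / ε := by
        rw [hA]; field_simp; ring
      have e4 : A * (ε * ‖x‖ ^ 2 + 1) ≤ A * Real.exp (ε * ‖x‖ ^ 2) := by gcongr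
      have e5 : 0 ≤ 2 * (ε * ‖x‖ ^ 2) + 2 / C * K / ε := by positivity
      linarith
    calc _ ≤ (A * Real.exp (ε * ‖x‖ ^ 2)) ^ p * Real.exp (-(c * ‖x‖ ^ 2) / 2) := by
          gcongr
          exact hlow x
      _ = A ^ p * Real.exp (p * ε * ‖x‖ ^ 2 + -(c * ‖x‖ ^ 2) / 2) := by
          rw [Real.mul_rpow hApos.le (Real.exp_pos _).le, ← Real.exp_mul, mul_assoc, ← Real.exp_add]
          ring_nf
      _ ≤ _ := by
          gcongr
          nlinarith [sq_nonneg ‖x‖]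

lemma aux_main {r : ℕ} (Q W : Matrix (Fin r) (Fin r) ℝ) (hQ : Q.PosDef) (hW : W.PosDef)
    (C p a P : ℝ) (hC : 0 < C) (hp : 0 < p) (ha : 0 < a)
    (φ : EuclideanSpace ℝ (Fin r) → ℝ)
    (hφ : ∀ x : EuclideanSpace ℝ (Fin r), φ x = a * Real.exp (-(x ⬝ᵥ W.mulVec x) / 2))
    (S : Set (EuclideanSpace ℝ (Fin r))) (hS : 0 < volume S)
    (hP : P = ∫ x in S, φ x) (h : ℕ → EuclideanSpace ℝ (Fin r))
    (hn : Tendsto (fun k => ‖h k‖) atTop atTop) :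
    Tendsto (fun k => (∫ x in S, (C + (x - h k) ⬝ᵥ Q.mulVec (x - h k)) ^ (-p) * (φ x / P)) *
      (C + h k ⬝ᵥ Q.mulVec (h k)) ^ p) atTop (nhds 1) := by
  have hφpos : ∀ x, 0 < φ x := fun x => by rw [hφ]; positivity
  have hφc : Continuous φ := by
    have : φ = fun x : EuclideanSpace ℝ (Fin r) => a * Real.exp (-(x ⬝ᵥ W.mulVec x) / 2) :=
      funext hφ
    rw [this]; fun_prop
  have hφi : Integrable φ := by
    have := (aux_int Q W hQ hW C 0 hC le_rfl).const_mul a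
    refine this.congr (ae_of_all _ fun x => ?_)
    simp [hφ]
  have hPpos : 0 < P := by
    rw [hP, integral_pos_iff_support_of_nonneg (fun x => (hφpos x).le) hφi.integrableOn]
    have : Function.support φ = Set.univ := by
      ext x; simp [(hφpos x).ne']
    simpa [this] using hS
  have hone : (1 : ℝ) = ∫ x in S, φ x / P := by
    rw [integral_div, ← hP, div_self hPpos.ne']
  rw [hone]
  simp only [← integral_mul_const]
  have hN : ∀ x : EuclideanSpace ℝ (Fin r), 0 < C + x ⬝ᵥ Q.mulVec x := fun x => by
    have := aux_nonneg Q hQ x; linarith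
  have hN' : ∀ x y : EuclideanSpace ℝ (Fin r), 0 < C + (x - y) ⬝ᵥ Q.mulVec (x - y) := fun x y => by
    simpa using hN (x - y)
  have e : ∀ (x : EuclideanSpace ℝ (Fin r)) k, (C + (x - h k) ⬝ᵥ Q.mulVec (x - h k)) ^ (-p) * (φ x / P) *
      (C + h k ⬝ᵥ Q.mulVec (h k)) ^ p =
      ((C + h k ⬝ᵥ Q.mulVec (h k)) / (C + (x - h k) ⬝ᵥ Q.mulVec (x - h k))) ^ p * (φ x / P) := by
    intro x k
    rw [Real.div_rpow (hN _).le (hN' _ _).le, Real.rpow_neg (hN' _ _).le]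
    ring
  apply tendsto_integral_of_dominated_convergence
    (fun x : EuclideanSpace ℝ (Fin r) => (2 + 2 / C * (x ⬝ᵥ Q.mulVec x)) ^ p * (φ x / P))
  · intro k
    apply Continuous.aestronglyMeasurable
    refine Continuous.mul (Continuous.mul ?_ (by fun_prop)) (by fun_prop)
    exact Continuous.rpow_const (by fun_prop) (fun x => Or.inl (hN' x _).ne')
  · have := (aux_int Q W hQ hW C p hC hp.le).const_mul (a / P)
    refine Integrable.integrableOn (this.congr (ae_of_all _ fun x => ?_))
    simp only [hφ]; ring
  · intro k
    refine ae_of_all _ fun x => ?_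
    rw [e]
    have h1 := hφpos x
    have h2 := hN (h k)
    have h3 := hN' x (h k)
    rw [Real.norm_of_nonneg (by positivity)]
    gcongr
    exact aux_dom Q hQ C hC x (h k)
  · refine ae_of_all _ fun x => ?_
    simp only [e]
    have h1 := (aux_ratio Q hQ C hC h hn x).inv₀ one_ne_zero
    simp only [inv_div, inv_one] at h1
    have h2 := (h1.rpow_const (p := p) (Or.inl one_ne_zero)).mul_const (φ x / P)
    simpa using h2

/-- For the one-sided test with the independence encompassing prior,
as |θ̂| → ∞ with at least one coordinate of θ̂ going to +∞, each normalized marginal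
k(Θt; θ̂) satisfies k(Θt; θ̂)·(νs²+s_y²+θ̂ᵀQθ̂)^{(n−r2+ν)/2} → 1, hence
k(Θ1; θ̂)/k(Θ0; θ̂) → 1 and the one-sided Bayes factor
B10 = (P_π(θ≤0)⁻¹ − 1)⁻¹ · k(Θ1; θ̂)/k(Θ0; θ̂) converges to the finite constant
(P_π(θ≤0)⁻¹ − 1)⁻¹ (information inconsistency). -/
theorem onesided_independence_prior_information_inconsistent
    (n r1 r2 : ℕ) (hn : 1 ≤ n) (hr1 : 1 ≤ r1)
    (Q Ω : Matrix (Fin r1) (Fin r1) ℝ) (hQ : Q.PosDef) (hΩ : Ω.PosDef)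
    (ν : ℝ) (hν : 0 ≤ ν) (hdf : 0 < (n:ℝ) - r2 + ν)
    (ssq : ℝ) (hs : 0 < ssq) (sysq : ℝ) (hsy : 0 < sysq)
    (φ : EuclideanSpace ℝ (Fin r1) → ℝ)
    (hφ : ∀ θ : EuclideanSpace ℝ (Fin r1),
      φ θ = (2 * Real.pi) ^ (-(r1:ℝ)/2) * Ω.det ^ (-(1:ℝ)/2) *
        Real.exp (-(θ ⬝ᵥ (Ω⁻¹).mulVec θ) / 2))
    (P0 P1 : ℝ)
    (hP0 : P0 = ∫ θ in negOrthant r1, φ θ)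
    (hP1 : P1 = ∫ θ in (negOrthant r1)ᶜ, φ θ)
    (k0 k1 : EuclideanSpace ℝ (Fin r1) → ℝ)
    (hk0 : ∀ θhat : EuclideanSpace ℝ (Fin r1),
      k0 θhat = ∫ θ in negOrthant r1,
        (ν * ssq + sysq + (θ - θhat) ⬝ᵥ Q.mulVec (θ - θhat))
          ^ (-(((n:ℝ) - r2 + ν) / 2)) * (φ θ / P0))
    (hk1 : ∀ θhat : EuclideanSpace ℝ (Fin r1),
      k1 θhat = ∫ θ in (negOrthant r1)ᶜ,
        (ν * ssq + sysq + (θ - θhat) ⬝ᵥ Q.mulVec (θ - θhat))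
          ^ (-(((n:ℝ) - r2 + ν) / 2)) * (φ θ / P1))
    (B10 : EuclideanSpace ℝ (Fin r1) → ℝ)
    (hB10 : ∀ θhat, B10 θhat = (P0⁻¹ - 1)⁻¹ * (k1 θhat / k0 θhat))
    (θseq : ℕ → EuclideanSpace ℝ (Fin r1))
    (hnorm : Tendsto (fun k => ‖θseq k‖) atTop atTop)
    (hcoord : ∃ i : Fin r1, Tendsto (fun k => θseq k i) atTop atTop) :
    (Tendsto (fun k => k0 (θseq k) *
      (ν * ssq + sysq + θseq k ⬝ᵥ Q.mulVec (θseq k)) ^ (((n:ℝ) - r2 + ν) / 2))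
      atTop (nhds 1)) ∧
    (Tendsto (fun k => k1 (θseq k) *
      (ν * ssq + sysq + θseq k ⬝ᵥ Q.mulVec (θseq k)) ^ (((n:ℝ) - r2 + ν) / 2))
      atTop (nhds 1)) ∧
    (Tendsto (fun k => k1 (θseq k) / k0 (θseq k)) atTop (nhds 1)) ∧
    (Tendsto (fun k => B10 (θseq k)) atTop (nhds ((P0⁻¹ - 1)⁻¹))) := by
  have hW := hΩ.inv
  have ha : 0 < (2 * Real.pi) ^ (-(r1:ℝ)/2) * Ω.det ^ (-(1:ℝ)/2) := by
    have := hΩ.det_pos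
    positivity
  have hC : 0 < ν * ssq + sysq := by positivity
  have hp : 0 < ((n:ℝ) - r2 + ν) / 2 := by positivity
  have hv0 : 0 < volume (negOrthant r1) := by
    have ho : IsOpen {x : EuclideanSpace ℝ (Fin r1) | ∀ i, x i < 0} := by
      simp only [Set.ofPred_forall]
      exact isOpen_iInter_of_finite fun i => isOpen_lt (by fun_prop) (by fun_prop)
    refine (ho.measure_pos volume ⟨WithLp.toLp 2 (fun _ => -1), by simp⟩).trans_le
      (measure_mono fun x hx i => (hx i).le)
  have hv1 : 0 < volume (negOrthant r1)ᶜ := by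
    have ho : IsOpen {x : EuclideanSpace ℝ (Fin r1) | 0 < x ⟨0, hr1⟩} :=
      isOpen_lt (by fun_prop) (by fun_prop)
    refine (ho.measure_pos volume ⟨WithLp.toLp 2 (fun _ => 1), by simp⟩).trans_le
      (measure_mono fun x hx hx' => absurd (hx' ⟨0, hr1⟩) (not_le.2 hx))
  have m0 := aux_main Q Ω⁻¹ hQ hW _ _ _ P0 hC hp ha φ hφ _ hv0 hP0 θseq hnorm
  have m1 := aux_main Q Ω⁻¹ hQ hW _ _ _ P1 hC hp ha φ hφ _ hv1 hP1 θseq hnorm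
  simp only [← hk0] at m0
  simp only [← hk1] at m1
  have m2 : Tendsto (fun k => k1 (θseq k) / k0 (θseq k)) atTop (nhds 1) := by
    have := m1.div m0 one_ne_zero
    rw [div_one] at this
    refine this.congr fun k => ?_
    have h0 := aux_nonneg Q hQ (θseq k)
    have : 0 < (ν * ssq + sysq + θseq k ⬝ᵥ Q.mulVec (θseq k)) ^ (((n:ℝ) - r2 + ν) / 2) :=
      Real.rpow_pos_of_pos (by linarith) _
    exact mul_div_mul_right _ _ this.ne'
  refine ⟨m0, m1, m2, ?_⟩
  simp only [hB10]
  simpa using m2.const_mul ((P0⁻¹ - 1)⁻¹)
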